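/- arXiv:2002.02492 — 6 statements merged into one kernel-verified Lean document; each statement's English description precedes it below -/
import Mathlib

section
/- There exist a real number ξ > 0 and a sequence model p on V such that (i) p s eos ≥ ξ for every prefix s : List V (hence NT_p(t) ≤ (1−ξ)^t for all t and NT_p(t) → 0 as t → ∞, i.e. p is consistent), and (ii) for every eos-free prefix s and every token v ≠ eos, p s eos < p s v (eos is the strictly least probable token at every step). Consequently any decoding algorithm that at each step considers only the (|V|−1) most likely tokens under p can never select eos. -/
open Finset Filter

/-- Non-termination mass of a sequence model `p` at horizon `t`. -/
noncomputable def NT {V : Type*} [Fintype V] [DecidableEq V]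
    (p : List V → V → ℝ) (eos : V) (t : ℕ) : ℝ :=
  ∑ y ∈ Finset.univ.filter (fun y : Fin t → V => ∀ i, y i ≠ eos),
    ∏ i : Fin t, p ((List.ofFn y).take i) (y i)

/-- The non-termination mass of an i.i.d. sequence model is geometric. -/
theorem NT_const {V : Type*} [Fintype V] [DecidableEq V] (q : V → ℝ) (eos : V) (t : ℕ) :
    NT (fun _ => q) eos t = (∑ v ∈ Finset.univ.erase eos, q v) ^ t := by
  have h : Finset.univ.filter (fun y : Fin t → V => ∀ i, y i ≠ eos)
      = Fintype.piFinset fun _ => Finset.univ.erase eos := by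
    ext y
    simp
  rw [NT, h, ← Finset.prod_univ_sum]
  simp

/-- If `eos` is strictly least likely, then a set of at most `|V| - 1` most likely tokens
does not contain it. -/
theorem notMem_of_forall_lt {V : Type*} [Fintype V] [DecidableEq V] {q : V → ℝ} {eos : V}
    (hq : ∀ v, v ≠ eos → q eos < q v) {T : Finset V} (hcard : T.card < Fintype.card V)
    (htop : ∀ v ∈ T, ∀ w ∉ T, q w ≤ q v) : eos ∉ T := by
  intro hmem
  obtain ⟨w, hw⟩ : ∃ w, w ∉ T := by
    by_contra! hall
    exact hcard.ne (Finset.card_eq_iff_eq_univ T |>.2 (Finset.eq_univ_of_forall hall))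
  have hne : w ≠ eos := fun h => hw (h ▸ hmem)
  exact (hq w hne).not_ge (htop eos hmem w hw)

/-- There exist `ξ > 0` and a consistent sequence model `p` on `V` such that
(i) `p s eos ≥ ξ` for every prefix (hence `NT_p(t) ≤ (1-ξ)^t → 0`, i.e. `p` is consistent), and
(ii) for every eos-free prefix `s` and every `v ≠ eos`, `p s eos < p s v`.
Consequently any decoding algorithm considering only the `|V|-1` most likely tokens at each
step can never select `eos`. -/
theorem stmt_0 {V : Type*} [Fintype V] [DecidableEq V]
    (hV : 1 < Fintype.card V) (eos : V) :
    ∃ (ξ : ℝ) (p : List V → V → ℝ), 0 < ξ ∧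
      ((∀ s v, 0 ≤ p s v) ∧ (∀ s : List V, ∑ v, p s v = 1)) ∧
      (∀ s : List V, ξ ≤ p s eos) ∧
      (∀ t : ℕ, NT p eos t ≤ (1 - ξ) ^ t) ∧
      Tendsto (fun t => NT p eos t) atTop (nhds 0) ∧
      (∀ s : List V, eos ∉ s → ∀ v, v ≠ eos → p s eos < p s v) ∧
      (∀ (S : List V → Finset V),
        (∀ s, (S s).card ≤ Fintype.card V - 1) →
        (∀ s, ∀ v ∈ S s, ∀ w ∉ S s, p s w ≤ p s v) →
        ∀ s : List V, eos ∉ s → eos ∉ S s) := by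
  have hn : (1 : ℝ) < Fintype.card V := by exact_mod_cast hV
  set c : ℝ := 2 * Fintype.card V - 1 with hc
  have hc1 : 1 < c := by linarith
  have hc0 : 0 < c := by linarith
  set q : V → ℝ := fun v => (if v = eos then 1 else 2) / c with hq
  have hqe : q eos = 1 / c := by simp [hq]
  have hqv : ∀ v, v ≠ eos → q v = 2 / c := fun v hv => by simp [hq, hv]
  have hlt : ∀ v, v ≠ eos → q eos < q v := fun v hv => by
    rw [hqe, hqv v hv]
    gcongr
    norm_num
  have herase : ∑ v ∈ Finset.univ.erase eos, q v = 1 - 1 / c := by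
    rw [Finset.sum_congr rfl fun v hv => hqv v (Finset.ne_of_mem_erase hv), Finset.sum_const,
      Finset.card_erase_of_mem (Finset.mem_univ _), Finset.card_univ, nsmul_eq_mul,
      Nat.cast_sub hV.le]
    field_simp
    push_cast
    linarith
  have hξ : 1 / c < 1 := (div_lt_one hc0).2 hc1
  have hξ0 : 0 < 1 / c := by positivity
  have hNT : ∀ t, NT (fun _ => q) eos t = (1 - 1 / c) ^ t := fun t => by rw [NT_const, herase]
  have hnonneg : ∀ v, 0 ≤ q v := fun v => by
    simp only [hq]
    positivity
  have hsum : ∑ v, q v = 1 := by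
    rw [← Finset.add_sum_erase _ _ (Finset.mem_univ eos), herase, hqe]
    ring
  refine ⟨1 / c, fun _ => q, hξ0, ⟨fun _ => hnonneg, fun _ => hsum⟩, fun _ => hqe.ge,
    fun t => (hNT t).le, ?_, fun _ _ => hlt, fun S hcard htop s _ => ?_⟩
  · simp only [hNT]
    exact tendsto_pow_atTop_nhds_zero_of_lt_one (by linarith) (by linarith)
  · exact notMem_of_forall_lt hlt (by have := hcard s; omega) (htop s)
end

section
/- Let V be a finite type with n = |V| elements and distinguished element eos, let p : V → ℝ be a probability distribution on V with p eos < p v for every v ≠ eos, and let 0 ≤ μ < 1. Enumerate V as v_1, …, v_n with p(v_i) ≥ p(v_j) whenever i < j, and let k_μ be the least k such that ∑_{i=1}^{k} p(v_i) > μ. If ∑_{v ≠ eos} p v > μ, then eos ∉ {v_1, …, v_{k_μ}}; that is, nucleus sampling with threshold μ assigns probability zero to eos. -/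
open Finset

/-- Nucleus sampling excludes `eos` when `eos` is strictly the least probable token and the
non-eos mass exceeds the threshold `μ`. Here `e : Fin n ≃ V` enumerates `V` in order of
non-increasing probability, and `kμ` is the least `k` such that the probability of the first
`k` tokens exceeds `μ`. Then no token of the nucleus `{v_1, …, v_{kμ}}` equals `eos`. -/
theorem stmt_4 {V : Type*} [Fintype V] [DecidableEq V] (eos : V)
    (p : V → ℝ) (hp0 : ∀ v, 0 ≤ p v) (hp1 : ∑ v, p v = 1)
    (heos : ∀ v, v ≠ eos → p eos < p v)
    (μ : ℝ) (hμ0 : 0 ≤ μ) (hμ1 : μ < 1)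
    (e : Fin (Fintype.card V) ≃ V)
    (hsort : ∀ i j : Fin (Fintype.card V), i < j → p (e j) ≤ p (e i))
    (kμ : ℕ)
    (hk : μ < ∑ i ∈ Finset.univ.filter (fun i : Fin (Fintype.card V) => (i : ℕ) < kμ), p (e i))
    (hmin : ∀ k < kμ,
      ∑ i ∈ Finset.univ.filter (fun i : Fin (Fintype.card V) => (i : ℕ) < k), p (e i) ≤ μ)
    (hmass : μ < ∑ v ∈ Finset.univ.filter (fun v => v ≠ eos), p v) :
    ∀ i : Fin (Fintype.card V), (i : ℕ) < kμ → e i ≠ eos := by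
  rintro i hi rfl
  refine (hmass.trans_le ?_).not_ge (hmin i hi)
  refine (Finset.sum_equiv e (fun j => ?_) fun _ _ => rfl).ge
  simp only [Finset.mem_filter, Finset.mem_univ, true_and, ne_eq, e.injective.eq_iff]
  refine ⟨fun h hji => h.ne (congrArg Fin.val hji), fun hji => ?_⟩
  by_contra! hle
  exact (heos (e j) (e.injective.ne hji)).not_ge
    (hsort i j (lt_of_le_of_ne hle (Ne.symm hji)))
end

section
/- Let V be a finite type with n = |V| elements, let p : V → ℝ be a probability distribution on V, and let 0 ≤ μ < 1. Enumerate V as v_1, …, v_n with p(v_i) ≥ p(v_j) whenever i < j, and let k_μ be the least k such that ∑_{i=1}^{k} p(v_i) > μ. If min_{v ∈ V} p v < 1 − μ, then k_μ < n; that is, the nucleus set V_μ = {v_1, …, v_{k_μ}} is a strict subset of V, so nucleus sampling is incomplete. -/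
open Finset

/-- Incompleteness of nucleus sampling: if the least probable token has probability less
than `1 - μ`, then the nucleus set `{v_1, …, v_{kμ}}` is a strict subset of `V`, i.e.
`kμ < |V|`. Here `e : Fin n ≃ V` enumerates `V` in order of non-increasing probability
and `kμ` is the least `k` such that the probability of the first `k` tokens exceeds `μ`. -/
theorem stmt_5 {V : Type*} [Fintype V] [Nonempty V]
    (p : V → ℝ) (hp0 : ∀ v, 0 ≤ p v) (hp1 : ∑ v, p v = 1)
    (μ : ℝ) (hμ0 : 0 ≤ μ) (hμ1 : μ < 1)
    (e : Fin (Fintype.card V) ≃ V)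
    (hsort : ∀ i j : Fin (Fintype.card V), i < j → p (e j) ≤ p (e i))
    (kμ : ℕ)
    (hk : μ < ∑ i ∈ Finset.univ.filter (fun i : Fin (Fintype.card V) => (i : ℕ) < kμ), p (e i))
    (hmin : ∀ k < kμ,
      ∑ i ∈ Finset.univ.filter (fun i : Fin (Fintype.card V) => (i : ℕ) < k), p (e i) ≤ μ)
    (hsmall : Finset.univ.inf' Finset.univ_nonempty p < 1 - μ) :
    kμ < Fintype.card V := by
  by_contra! hle
  have hn : 0 < Fintype.card V := Fintype.card_pos
  let l : Fin (Fintype.card V) := ⟨Fintype.card V - 1, by omega⟩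
  have hinit := hmin (Fintype.card V - 1) (by omega)
  have hfilter : Finset.univ.filter
      (fun i : Fin (Fintype.card V) => (i : ℕ) < Fintype.card V - 1) = Finset.univ.erase l := by
    ext i
    simp only [Finset.mem_filter, Finset.mem_univ, true_and, Finset.mem_erase, and_true, ne_eq,
      Fin.ext_iff, l]
    omega
  have htotal : p (e l) + ∑ i ∈ Finset.univ.erase l, p (e i) = 1 := by
    rw [Finset.add_sum_erase _ (fun i => p (e i)) (Finset.mem_univ l), e.sum_comp p, hp1]
  rw [hfilter] at hinit
  have hlast : ∀ v, p (e l) ≤ p v := by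
    intro v
    obtain ⟨i, rfl⟩ := e.surjective v
    rcases eq_or_ne i l with rfl | hne
    · exact le_rfl
    · have hval : (i : ℕ) ≠ Fintype.card V - 1 := fun h => hne (Fin.ext h)
      exact hsort i l (Fin.lt_def.mpr (show (i : ℕ) < Fintype.card V - 1 by omega))
  have hinf : p (e l) ≤ Finset.univ.inf' Finset.univ_nonempty p :=
    Finset.le_inf' _ _ fun v _ => hlast v
  linarith
end

section
/- Let p be a sequence model on V and ξ > 0 such that p s eos ≥ ξ for every prefix s : List V. Then for every t ∈ ℕ, NT_p(t) ≤ (1 − ξ)^t, and consequently NT_p(t) → 0 as t → ∞; that is, p is consistent. -/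
open Finset Filter

theorem NT_zero {V : Type*} [Fintype V] [DecidableEq V] (p : List V → V → ℝ) (eos : V) :
    NT p eos 0 = 1 := by
  simp [NT]

/-- Conditioning on the first token: the non-termination mass at horizon `t + 1` averages the
masses at horizon `t` of the models shifted by a first token other than `eos`. -/
theorem NT_succ {V : Type*} [Fintype V] [DecidableEq V] (p : List V → V → ℝ) (eos : V) (t : ℕ) :
    NT p eos (t + 1) =
      ∑ v ∈ Finset.univ.erase eos, p [] v * NT (fun s => p (v :: s)) eos t := by
  simp only [NT, Finset.mul_sum]
  rw [Finset.sum_sigma']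
  refine Finset.sum_bij' (fun y _ => ⟨y 0, Fin.tail y⟩)
    (fun z _ => (Fin.cons z.1 z.2 : Fin (t + 1) → V)) ?_ ?_ ?_ ?_ ?_
  · intro y hy
    simp only [Finset.mem_filter, Finset.mem_univ, true_and] at hy
    simp [hy, Fin.tail]
  · rintro ⟨v, z⟩ hz
    simp only [Finset.mem_sigma, Finset.mem_erase, Finset.mem_filter, Finset.mem_univ,
      true_and, and_true] at hz
    simpa [Fin.forall_fin_succ] using hz
  · intro y _
    simp
  · rintro ⟨v, z⟩ _
    simp
  · intro y _
    simp [Fin.prod_univ_succ, List.ofFn_succ, Fin.tail_def]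

theorem NT_nonneg {V : Type*} [Fintype V] [DecidableEq V] (p : List V → V → ℝ) (eos : V)
    (hp0 : ∀ s v, 0 ≤ p s v) (t : ℕ) : 0 ≤ NT p eos t :=
  Finset.sum_nonneg fun _ _ => Finset.prod_nonneg fun _ _ => hp0 _ _

theorem sum_erase_eos_le {V : Type*} [Fintype V] [DecidableEq V] {q : V → ℝ} {eos : V} {ξ : ℝ}
    (hq : ∑ v, q v = 1) (heos : ξ ≤ q eos) : ∑ v ∈ Finset.univ.erase eos, q v ≤ 1 - ξ := by
  have h := Finset.add_sum_erase Finset.univ q (Finset.mem_univ eos)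
  linarith

theorem one_sub_nonneg_of_le_eos {V : Type*} [Fintype V] [DecidableEq V] {q : V → ℝ} {eos : V}
    {ξ : ℝ} (hq0 : ∀ v, 0 ≤ q v) (hq : ∑ v, q v = 1) (heos : ξ ≤ q eos) : 0 ≤ 1 - ξ :=
  (Finset.sum_nonneg fun v _ => hq0 v).trans (sum_erase_eos_le hq heos)

theorem NT_le_pow {V : Type*} [Fintype V] [DecidableEq V] (eos : V) (p : List V → V → ℝ)
    (hp0 : ∀ s v, 0 ≤ p s v) (hp1 : ∀ s : List V, ∑ v, p s v = 1)
    (ξ : ℝ) (heos : ∀ s : List V, ξ ≤ p s eos) (t : ℕ) : NT p eos t ≤ (1 - ξ) ^ t := by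
  induction t generalizing p with
  | zero => simp [NT_zero]
  | succ t ih =>
    have hξ : 0 ≤ 1 - ξ := one_sub_nonneg_of_le_eos (hp0 []) (hp1 []) (heos [])
    calc NT p eos (t + 1)
        = ∑ v ∈ Finset.univ.erase eos, p [] v * NT (fun s => p (v :: s)) eos t := NT_succ p eos t
      _ ≤ ∑ v ∈ Finset.univ.erase eos, p [] v * (1 - ξ) ^ t := by
          gcongr with v
          · exact hp0 [] v
          · exact ih _ (fun s => hp0 (v :: s)) (fun s => hp1 (v :: s)) (fun s => heos (v :: s))
      _ = (∑ v ∈ Finset.univ.erase eos, p [] v) * (1 - ξ) ^ t := by rw [Finset.sum_mul]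
      _ ≤ (1 - ξ) * (1 - ξ) ^ t := by
          gcongr
          exact sum_erase_eos_le (hp1 []) (heos [])
      _ = (1 - ξ) ^ (t + 1) := (pow_succ' _ _).symm

/-- If a sequence model assigns probability at least `ξ > 0` to `eos` after every prefix,
then its non-termination mass at horizon `t` is at most `(1 - ξ)^t`, and it tends to `0`,
i.e. the model is consistent. -/
theorem stmt_7 {V : Type*} [Fintype V] [DecidableEq V] (eos : V)
    (p : List V → V → ℝ)
    (hp0 : ∀ s v, 0 ≤ p s v) (hp1 : ∀ s : List V, ∑ v, p s v = 1)
    (ξ : ℝ) (hξ : 0 < ξ) (heos : ∀ s : List V, ξ ≤ p s eos) :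
    (∀ t : ℕ, NT p eos t ≤ (1 - ξ) ^ t) ∧
      Tendsto (fun t => NT p eos t) atTop (nhds 0) := by
  have hle := NT_le_pow eos p hp0 hp1 ξ heos
  have h0 : 0 ≤ 1 - ξ := one_sub_nonneg_of_le_eos (hp0 []) (hp1 []) (heos [])
  exact ⟨hle, squeeze_zero (NT_nonneg p eos hp0) hle
    (tendsto_pow_atTop_nhds_zero_of_lt_one h0 (by linarith))⟩
end

section
/- Let ε ∈ (0, 1) and σ : ℕ → ℝ with 0 ≤ σ i ≤ 1 − ε for all i. Define p t = 1 − ∏_{i=0}^{t} σ i. Then (i) p t ≥ 1 − (1 − ε)^{t+1} for every t ∈ ℕ, and (ii) p is monotone non-decreasing: p t ≤ p (t+1) for every t. In particular p t → 1 as t → ∞. -/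
open Finset Filter

/-- For `ε ∈ (0,1)` and `σ i ∈ [0, 1-ε]`, the quantity `p t = 1 - ∏_{i=0}^{t} σ i`
satisfies `p t ≥ 1 - (1-ε)^{t+1}`, is monotone non-decreasing, and tends to `1`. -/
theorem stmt_15 (ε : ℝ) (hε : ε ∈ Set.Ioo (0 : ℝ) 1)
    (σ : ℕ → ℝ) (hσ : ∀ i, σ i ∈ Set.Icc (0 : ℝ) (1 - ε))
    (p : ℕ → ℝ) (hp : ∀ t, p t = 1 - ∏ i ∈ Finset.range (t + 1), σ i) :
    (∀ t : ℕ, 1 - (1 - ε) ^ (t + 1) ≤ p t) ∧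
      Monotone p ∧
      Tendsto p atTop (nhds 1) := by
  obtain ⟨hε0, hε1⟩ := hε
  have prod_nonneg (n : ℕ) : 0 ≤ ∏ i ∈ Finset.range n, σ i :=
    Finset.prod_nonneg fun i _ => (hσ i).1
  have lower (t : ℕ) : 1 - (1 - ε) ^ (t + 1) ≤ p t := by
    have h : ∏ i ∈ Finset.range (t + 1), σ i ≤ ∏ _i ∈ Finset.range (t + 1), (1 - ε) :=
      Finset.prod_le_prod (fun i _ => (hσ i).1) fun i _ => (hσ i).2
    rw [Finset.prod_const, Finset.card_range] at h
    rw [hp]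
    linarith
  refine ⟨lower, monotone_nat_of_le_succ fun t => ?_, ?_⟩
  · rw [hp, hp, Finset.prod_range_succ _ (t + 1)]
    have h := mul_le_of_le_one_right (prod_nonneg (t + 1))
      (show σ (t + 1) ≤ 1 by linarith [(hσ (t + 1)).2])
    linarith
  · have hpow : Tendsto (fun t : ℕ => (1 - ε) ^ (t + 1)) atTop (nhds 0) :=
      (tendsto_pow_atTop_nhds_zero_of_lt_one (by linarith) (by linarith)).comp
        (tendsto_add_atTop_nat 1)
    have hlim : Tendsto (fun t : ℕ => 1 - (1 - ε) ^ (t + 1)) atTop (nhds 1) := by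
      simpa using hpow.const_sub 1
    refine tendsto_of_tendsto_of_tendsto_of_le_of_le hlim tendsto_const_nhds lower fun t => ?_
    rw [hp]
    linarith [prod_nonneg (t + 1)]
end

section
/- Let ε ∈ (0, 1) and let p be a sequence model on V such that for every eos-free prefix s, p s eos ≥ 1 − (1 − ε)^{|s| + 1}, where |s| is the length of s. Then every greedy sequence y of p satisfies y t = eos for some t ≤ ⌈log 2 / (− log(1 − ε))⌉; that is, greedy decoding from a self-terminating recurrent language model always terminates within −log 2 / log(1 − ε) steps (in particular, greedy decoding is consistent with respect to any self-terminating recurrent language model). -/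
open Finset

/-- With `N = ⌈log 2 / (-log r)⌉`, the power `r ^ (N + 1)` has dropped below one half. -/
theorem pow_ceil_log_two_div_neg_log_succ_lt_half {r : ℝ} (hr0 : 0 < r) (hr1 : r < 1) :
    r ^ (⌈Real.log 2 / (-Real.log r)⌉₊ + 1) < 1 / 2 := by
  have hlog : 0 < -Real.log r := neg_pos.mpr (Real.log_neg hr0 hr1)
  have hN := (div_le_iff₀ hlog).mp (Nat.le_ceil (Real.log 2 / (-Real.log r)))
  rw [← Real.log_lt_log_iff (by positivity) (by norm_num), Real.log_pow, one_div, Real.log_inv]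
  push_cast
  linarith

/-- An outcome of probability more than one half is the only mode of a finite distribution. -/
theorem eq_of_half_lt_of_forall_le {V : Type*} [Fintype V] {q : V → ℝ}
    (hq0 : ∀ v, 0 ≤ q v) (hq1 : ∑ v, q v = 1) {a b : V} (ha : 1 / 2 < q a)
    (hb : ∀ v, q v ≤ q b) : b = a := by
  classical
  by_contra hne
  have hsum : ∑ v ∈ {b, a}, q v ≤ ∑ v, q v :=
    sum_le_sum_of_subset_of_nonneg (subset_univ _) fun v _ _ => hq0 v
  rw [sum_pair hne, hq1] at hsum
  linarith [hb a]

/-- Greedy decoding is consistent with respect to any self-terminating recurrent language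
model: if `p` is a sequence model satisfying `p s eos ≥ 1 - (1-ε)^{|s|+1}` for every
eos-free prefix `s`, then every greedy sequence of `p` produces `eos` within
`⌈log 2 / (-log (1-ε))⌉` steps. -/
theorem stmt_16 {V : Type*} [Fintype V] [DecidableEq V] (eos : V)
    (ε : ℝ) (hε : ε ∈ Set.Ioo (0 : ℝ) 1)
    (p : List V → V → ℝ)
    (hp0 : ∀ s v, 0 ≤ p s v) (hp1 : ∀ s : List V, ∑ v, p s v = 1)
    (heos : ∀ s : List V, eos ∉ s → 1 - (1 - ε) ^ (s.length + 1) ≤ p s eos)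
    (y : ℕ → V)
    (hy : ∀ t : ℕ, ∀ v, p (List.ofFn fun i : Fin t => y i) v ≤
        p (List.ofFn fun i : Fin t => y i) (y t)) :
    ∃ t ≤ ⌈Real.log 2 / (-Real.log (1 - ε))⌉₊, y t = eos := by
  set N := ⌈Real.log 2 / (-Real.log (1 - ε))⌉₊ with hN
  by_cases hmem : eos ∈ List.ofFn fun i : Fin N => y i
  · obtain ⟨i, hi⟩ := (List.mem_ofFn' _ _).mp hmem
    exact ⟨i, i.isLt.le, hi⟩
  · refine ⟨N, le_rfl, eq_of_half_lt_of_forall_le (hp0 _) (hp1 _) ?_ (hy N)⟩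
    have hlow := heos _ hmem
    have hpow := pow_ceil_log_two_div_neg_log_succ_lt_half (r := 1 - ε)
      (sub_pos.mpr hε.2) (sub_lt_self 1 hε.1)
    rw [← hN] at hpow
    rw [List.length_ofFn] at hlow
    linarith
end
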